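/- arXiv:1409.1597 — 6 statements merged into one kernel-verified Lean document; each statement's English description precedes it below -/
import Mathlib

section
/- Let G be an infinite group and n ∈ ℕ. A subset A of G is n-thin if and only if |ϑ_p(A)| ≤ n for every p ∈ G*. -/
open Pointwise

/-- `gp`: the image of `p` under the left shift `x ↦ g * x`. -/
def SmulUf {G : Type*} [Group G] (g : G) (p : Ultrafilter G) : Ultrafilter G :=
  p.map (fun x => g * x)

/-- `p` is a free (non-principal) ultrafilter. -/
def FreeUf {G : Type*} (p : Ultrafilter G) : Prop := ∀ g : G, p ≠ pure g

/-- The `p`-companion `ϑ_p(A) = {gp : g ∈ G, A ∈ gp}`. -/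
def Theta {G : Type*} [Group G] (A : Set G) (p : Ultrafilter G) : Set (Ultrafilter G) :=
  {q | ∃ g : G, q = SmulUf g p ∧ A ∈ q}

/-- `A` is `n`-thin: for every finite `F ∋ e` there is a finite `H` with
`|Fa ∩ A| ≤ n` for all `a ∈ A ∖ H`. -/
def NThin {G : Type*} [Group G] (n : ℕ) (A : Set G) : Prop :=
  ∀ F : Set G, F.Finite → (1 : G) ∈ F →
    ∃ H : Set G, H.Finite ∧ ∀ a ∈ A \ H,
      Cardinal.mk (((fun f => f * a) '' F) ∩ A : Set G) ≤ n

lemma smulUf_fixed {G : Type*} [Group G] (x : G) (p : Ultrafilter G)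
    (h : SmulUf x p = p) : x = 1 := by
  by_contra hx
  obtain ⟨M, hM⟩ := zorn_subset {M : Set G | ∀ y ∈ M, x * y ∉ M} (by
    intro c hc hch
    refine ⟨⋃₀ c, ?_, fun s hs => Set.subset_sUnion_of_mem hs⟩
    rintro y ⟨s, hs, hys⟩ ⟨t, ht, hyt⟩
    rcases hch.total hs ht with hst | hst
    · exact hc ht y (hst hys) hyt
    · exact hc hs y hys (hst hyt))
  have inv : ∀ s : Set G, s ∈ p ↔ {y | x * y ∈ s} ∈ p := by
    intro s
    conv_lhs => rw [← h]
    exact Ultrafilter.mem_map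
  have cover : ∀ y, y ∈ M ∨ x * y ∈ M ∨ x⁻¹ * y ∈ M := by
    intro y
    by_contra! hy
    obtain ⟨h1, h2, h3⟩ := hy
    have : insert y M ⊆ M := by
      refine hM.2 ?_ (Set.subset_insert _ _)
      intro z hz hz'
      rcases hz with rfl | hz
      · rcases hz' with h | h
        · exact hx (by simpa using h)
        · exact h2 h
      · rcases hz' with h | h
        · apply h3
          rw [← h]
          simpa using hz
        · exact hM.1 z hz h
    exact h1 (this (Set.mem_insert _ _))
  have hMp : M ∈ p := by
    have : M ∪ ({y | x * y ∈ M} ∪ {y | x⁻¹ * y ∈ M}) ∈ p :=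
      Filter.mem_of_superset Filter.univ_mem (fun y _ => cover y)
    rcases Ultrafilter.union_mem_iff.1 this with h | h
    · exact h
    rcases Ultrafilter.union_mem_iff.1 h with h | h
    · exact (inv M).2 h
    · have := (inv _).1 h
      simpa using this
  obtain ⟨y, h1, h2⟩ := p.nonempty_of_mem (Filter.inter_mem hMp ((inv M).1 hMp))
  exact hM.1 y h1 h2

lemma smulUf_inj {G : Type*} [Group G] (p : Ultrafilter G) (g h : G)
    (e : SmulUf g p = SmulUf h p) : g = h := by
  have : SmulUf (h⁻¹ * g) p = p := by
    have e2 := congrArg (SmulUf h⁻¹) e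
    unfold SmulUf at *
    rw [Ultrafilter.map_map, Ultrafilter.map_map] at e2
    simpa [Function.comp_def, mul_assoc] using e2
  have := smulUf_fixed _ _ this
  exact (inv_mul_eq_one.1 this).symm

lemma free_not_finite {G : Type*} (p : Ultrafilter G) (hp : FreeUf p) (s : Set G)
    (hs : s.Finite) : s ∉ p := by
  intro h
  obtain ⟨x, -, hx⟩ := Ultrafilter.eq_pure_of_finite_mem hs h
  exact hp x hx

theorem nthin_iff_ultracompanions {G : Type*} [Group G] [Infinite G]
    (n : ℕ) (A : Set G) :
    NThin n A ↔ ∀ p : Ultrafilter G, FreeUf p → Cardinal.mk (Theta A p) ≤ n := by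
  constructor
  · intro hA p hp
    apply Cardinal.card_le_of
    intro s
    by_contra! hs
    have hne : s.Nonempty := Finset.card_pos.1 (by omega)
    obtain ⟨t0, ht0⟩ := hne
    choose g hg hgA using fun t : Theta A p => t.2
    have hgA' : ∀ t, {b | g t * b ∈ A} ∈ p := by
      intro t
      have := hgA t
      rw [hg t] at this
      exact Ultrafilter.mem_map.1 this
    have ginj : Function.Injective g := by
      intro t t' e
      apply Subtype.ext
      rw [hg t, hg t', e]
    obtain ⟨H, hH, hHA⟩ := hA ((fun t => g t * (g t0)⁻¹) '' (s : Set _))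
      (s.finite_toSet.image _) ⟨t0, ht0, by simp⟩
    have hfin : {b | g t0 * b ∈ H} ∉ p :=
      free_not_finite p hp _ (hH.preimage (mul_right_injective (g t0)).injOn)
    have hB : (⋂ t ∈ s, {b | g t * b ∈ A}) ∈ p :=
      (Filter.biInter_finset_mem s).2 (fun t _ => hgA' t)
    obtain ⟨b, hb, hb'⟩ := p.nonempty_of_mem
      (Filter.inter_mem hB (Ultrafilter.compl_mem_iff_notMem.2 hfin))
    simp only [Set.mem_iInter, Set.mem_setOf_eq] at hb
    have hle := hHA (g t0 * b) ⟨hb t0 ht0, hb'⟩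
    have hcard : Cardinal.mk s ≤ n := by
      refine le_trans (Cardinal.mk_le_of_injective
        (f := fun t : s => ⟨g t * b, ⟨_, ⟨t.1, t.2, rfl⟩, by simp [mul_assoc]⟩, hb t t.2⟩) ?_) hle
      intro t t' e
      exact Subtype.ext (ginj (mul_right_cancel (congrArg Subtype.val e)))
    rw [Cardinal.mk_coe_finset] at hcard
    have : s.card ≤ n := by exact_mod_cast hcard
    omega
  · intro hT F hF _
    by_cases hE : {a ∈ A | ¬ Cardinal.mk (((fun f => f * a) '' F) ∩ A : Set G) ≤ n}.Finite
    · refine ⟨_, hE, ?_⟩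
      rintro a ⟨ha, ha'⟩
      by_contra h
      exact ha' ⟨ha, h⟩
    exfalso
    have hI : Set.Infinite _ := hE
    haveI := hI.cofinite_inf_principal_neBot
    obtain ⟨p, hp⟩ := Ultrafilter.exists_le (Filter.cofinite ⊓ Filter.principal
      {a ∈ A | ¬ Cardinal.mk (((fun f => f * a) '' F) ∩ A : Set G) ≤ n})
    have hfree : FreeUf p := by
      rintro x rfl
      have : ({x}ᶜ : Set G) ∈ (pure x : Ultrafilter G) :=
        hp (Filter.mem_inf_of_left (Set.finite_singleton x).compl_mem_cofinite)
      simp at this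
    have hEp := hp (Filter.mem_inf_of_right (Filter.mem_principal_self _))
    have hB : (⋂ f ∈ F, {a | f * a ∈ A → A ∈ SmulUf f p}) ∈ p := by
      refine (Filter.biInter_mem hF).2 fun f _ => ?_
      by_cases hf : A ∈ SmulUf f p
      · simp [hf]
      · have : {a | f * a ∈ A} ∉ p := fun h => hf (Ultrafilter.mem_map.2 h)
        exact Filter.mem_of_superset (Ultrafilter.compl_mem_iff_notMem.2 this)
          (fun a ha h => absurd h ha)
    obtain ⟨a, ⟨_, ha⟩, hb⟩ := p.nonempty_of_mem (Filter.inter_mem hEp hB)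
    simp only [Set.mem_iInter, Set.mem_setOf_eq] at hb
    apply ha
    refine le_trans (Cardinal.mk_le_of_injective
      (f := fun y => (⟨SmulUf (y.1 * a⁻¹) p, y.1 * a⁻¹, rfl, ?_⟩ : Theta A p)) ?_) (hT p hfree)
    · obtain ⟨y, ⟨f, hf, rfl⟩, hy⟩ := y
      simpa using hb f hf hy
    · intro y y' e
      exact Subtype.ext (mul_right_cancel (smulUf_inj p _ _ (congrArg Subtype.val e)))
end

section
/- Let F_A be the free group on a nonempty alphabet A and let κ = |F_A|. Then F_A can be partitioned into two disjoint subsets B₁ and B₂ (F_A = B₁ ∪ B₂, B₁ ∩ B₂ = ∅) such that neither B₁ nor B₂ is left κ-large. -/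
open Pointwise

/-- `A` is left `κ`-large: `G = FA` for some `F` with `|F| < κ`. -/
def LeftKLarge {G : Type*} [Group G] (kappa : Cardinal) (A : Set G) : Prop :=
  ∃ F : Set G, Cardinal.mk F < kappa ∧ Set.univ = F * A

theorem fg_step {A : Type*} [DecidableEq A] (x : A × Bool) (h : FreeGroup A) :
    (FreeGroup.mk [x] * h).toWord = x :: h.toWord ∨
      h.toWord = (x.1, !x.2) :: (FreeGroup.mk [x] * h).toWord := by
  have e : (FreeGroup.mk [x] * h).toWord = FreeGroup.reduce (x :: h.toWord) := by
    conv_lhs => rw [← FreeGroup.mk_toWord (x := h), FreeGroup.mul_mk, FreeGroup.toWord_mk]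
    rfl
  rw [e, FreeGroup.reduce.cons, FreeGroup.reduce_toWord]
  rcases x with ⟨a, b⟩
  rcases h.toWord with _ | ⟨⟨c, d⟩, t⟩
  · simp
  · by_cases hc : a = c ∧ b = !d
    · obtain ⟨rfl, rfl⟩ := hc
      simp
    · simp [hc]

theorem fg_pow {A : Type*} [DecidableEq A] (x : A × Bool) (k : ℕ) : ∀ (h : FreeGroup A),
    h.toWord.length ≤ k → ∀ n, k < n →
      (FreeGroup.mk [x] ^ n * h).toWord.head? = some x := by
  have stay : ∀ (n : ℕ) (h : FreeGroup A), h.toWord.head? = some x →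
      (FreeGroup.mk [x] ^ n * h).toWord.head? = some x := by
    intro n
    induction n with
    | zero => intro h hh; simpa using hh
    | succ n ih =>
      intro h hh
      rw [pow_succ, mul_assoc]
      apply ih
      rcases fg_step x h with h1 | h1
      · simp [h1]
      · rw [h1] at hh
        rcases x with ⟨a, b⟩
        simp at hh
  induction k with
  | zero =>
    intro h hl n hn
    obtain ⟨m, rfl⟩ : ∃ m, n = m + 1 := ⟨n - 1, by omega⟩
    rw [pow_succ, mul_assoc]
    apply stay
    rcases fg_step x h with h1 | h1
    · simp [h1]
    · simp [h1] at hl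
  | succ k ih =>
    intro h hl n hn
    obtain ⟨m, rfl⟩ : ∃ m, n = m + 1 := ⟨n - 1, by omega⟩
    rw [pow_succ, mul_assoc]
    rcases fg_step x h with h1 | h1
    · apply stay
      simp [h1]
    · apply ih
      · rw [h1] at hl
        simpa using hl
      · omega

theorem fg_core {A : Type*} [DecidableEq A] [Nonempty A] (b : Bool) (F : Set (FreeGroup A))
    (hF : Cardinal.mk F < Cardinal.mk (FreeGroup A)) :
    ∃ (g : FreeGroup A) (a : A), ∀ f ∈ F, (g * f).toWord.head? = some (a, b) := by
  have hle : Cardinal.mk (FreeGroup A) ≤ max (Cardinal.mk A) Cardinal.aleph0 := by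
    rw [Cardinal.mk_freeGroup]
  rcases lt_or_ge (Cardinal.mk F) Cardinal.aleph0 with hf | hf
  · have hfin : F.Finite := Cardinal.lt_aleph0_iff_set_finite.1 hf
    obtain ⟨k, hk⟩ := (hfin.image (fun f => f.toWord.length)).bddAbove
    obtain ⟨a⟩ := ‹Nonempty A›
    exact ⟨FreeGroup.mk [(a, b)] ^ (k + 1), a, fun f hfF =>
      fg_pow (a, b) k f (hk ⟨f, hfF, rfl⟩) _ (Nat.lt_succ_self k)⟩
  · have hA : Cardinal.mk F < Cardinal.mk A := by
      rcases lt_max_iff.1 (hF.trans_le hle) with h | h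
      · exact h
      · exact absurd h (not_lt.2 hf)
    obtain ⟨a0⟩ := ‹Nonempty A›
    let l : FreeGroup A → A := fun f => (f.toWord.headD (a0, true)).1
    have : ∃ a, a ∉ l '' F := by
      by_contra hc
      push Not at hc
      have h1 : Cardinal.mk (l '' F) ≤ Cardinal.mk F := Cardinal.mk_image_le
      rw [Set.eq_univ_of_forall hc, Cardinal.mk_univ] at h1
      exact absurd hA (not_lt.2 h1)
    obtain ⟨a, ha⟩ := this
    refine ⟨FreeGroup.mk [(a, b)], a, fun f hfF => ?_⟩
    rcases fg_step (a, b) f with h1 | h1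
    · simp [h1]
    · exact absurd ⟨f, hfF, by simp [l, h1]⟩ ha

/-- Every free group `F_A` (on a nonempty alphabet `A`), with `κ = |F_A|`, can be
partitioned into two subsets neither of which is left `κ`-large. -/
theorem free_group_partition_not_left_large (A : Type*) [Nonempty A] :
    ∃ B₁ B₂ : Set (FreeGroup A), B₁ ∪ B₂ = Set.univ ∧ Disjoint B₁ B₂ ∧
      ¬ LeftKLarge (Cardinal.mk (FreeGroup A)) B₁ ∧
      ¬ LeftKLarge (Cardinal.mk (FreeGroup A)) B₂ := by
  classical
  let B : Set (FreeGroup A) := {f | ∃ a, (f⁻¹).toWord.head? = some (a, true)}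
  have key : ∀ (b : Bool) (S : Set (FreeGroup A)),
      (∀ f ∈ S, ∀ a, (f⁻¹).toWord.head? ≠ some (a, b)) →
      ¬ LeftKLarge (Cardinal.mk (FreeGroup A)) S := by
    rintro b S hS ⟨F, hF, hu⟩
    obtain ⟨g, a, hg⟩ := fg_core b F hF
    have : g⁻¹ ∈ F * S := hu ▸ Set.mem_univ _
    obtain ⟨f, hf, s, hs, hfs⟩ := Set.mem_mul.1 this
    apply hS s hs a
    have : s⁻¹ = g * f := by
      rw [← inv_inj, inv_inv, mul_inv_rev, ← hfs]; group
    rw [this]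
    exact hg f hf
  refine ⟨B, Bᶜ, Set.union_compl_self B, disjoint_compl_right, key false B ?_, key true Bᶜ ?_⟩
  · rintro f ⟨a, ha⟩ c hc
    rw [ha] at hc
    simp at hc
  · intro f hf a ha
    exact hf ⟨a, ha⟩
end

section
/- Let G be an infinite group of cardinality κ and suppose that either κ is a regular cardinal or G is a free group. Then G admits no maximal left invariant κ-bounded topology; that is, there is no topology τ on G such that every left shift x ↦ gx is τ-continuous, τ has no isolated points, every nonempty τ-open set is left κ-large, and every topology on G strictly finer than τ has an isolated point. -/
open Pointwise

open Topology

def ThickSet {G : Type*} [Group G] (A : Set G) : Prop :=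
  ∀ F : Set G, Cardinal.mk F < Cardinal.mk G → ∃ y, ∀ f ∈ F, f * y ∈ A

theorem ThickSet.not_large {G : Type*} [Group G] {A B : Set G} (hA : ThickSet A)
    (hAB : Disjoint A B) : ¬ LeftKLarge (Cardinal.mk G) B := by
  rintro ⟨F, hF, hU⟩
  obtain ⟨y, hy⟩ := hA F⁻¹ (by rwa [Cardinal.mk_inv])
  have : y ∈ F * B := hU ▸ Set.mem_univ y
  obtain ⟨f, hf, b, hb, rfl⟩ := Set.mem_mul.1 this
  have h1 := hy f⁻¹ (Set.inv_mem_inv.2 hf)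
  rw [inv_mul_cancel_left] at h1
  exact Set.disjoint_left.1 hAB h1 hb

theorem ThickSet.diff_singleton {G : Type*} [Group G] [Infinite G] {A : Set G} (hA : ThickSet A)
    (x : G) : ThickSet (A \ {x}) := by
  intro F hF
  have hinf := Cardinal.aleph0_le_mk G
  have h1 : Cardinal.mk (F⁻¹ * F : Set G) < Cardinal.mk G := by
    refine Cardinal.mk_mul_le.trans_lt (Cardinal.mul_lt_of_lt hinf ?_ hF)
    rwa [Cardinal.mk_inv]
  obtain ⟨k, hk⟩ : ∃ k, k ∉ F⁻¹ * F := by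
    by_contra! hc
    rw [Set.eq_univ_of_forall hc, Cardinal.mk_univ] at h1
    exact lt_irrefl _ h1
  obtain ⟨y, hy⟩ := hA (F ∪ (fun f => f * k) '' F)
    ((Cardinal.mk_union_le _ _).trans_lt
      (Cardinal.add_lt_of_lt hinf hF (Cardinal.mk_image_le.trans_lt hF)))
  by_cases hx : ∃ f ∈ F, f * y = x
  · obtain ⟨f, hf, hfx⟩ := hx
    refine ⟨k * y, fun f' hf' => ⟨?_, ?_⟩⟩
    · rw [← mul_assoc]
      exact hy _ (Or.inr ⟨f', hf', rfl⟩)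
    · intro h2
      have h2 : f' * (k * y) = x := h2
      apply hk
      refine Set.mem_mul.2 ⟨f'⁻¹, Set.inv_mem_inv.2 hf', f, hf, ?_⟩
      rw [← hfx, ← mul_assoc] at h2
      rw [← mul_right_cancel h2, inv_mul_cancel_left]
  · push Not at hx
    exact ⟨y, fun f hf => ⟨hy f (Or.inl hf), hx f hf⟩⟩

theorem exists_thick_regular {G : Type u} [Group G] [Infinite G]
    (h : (Cardinal.mk G).IsRegular) : ∃ A : Set G, ThickSet A ∧ ThickSet Aᶜ := by
  classical
  have hinf := Cardinal.aleph0_le_mk G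
  have hcard : Cardinal.mk (G × Bool) = Cardinal.mk G := by
    rw [Cardinal.mk_prod]
    simp only [Cardinal.lift_id, Cardinal.lift_uzero, Cardinal.mk_bool]
    simpa using Cardinal.mul_eq_left hinf ((Cardinal.nat_lt_aleph0 2).le.trans hinf) (by simp)
  obtain ⟨r, wo, hr⟩ := Cardinal.exists_ord_eq (G × Bool)
  have hIio : ∀ i, Cardinal.mk {j | r j i} < Cardinal.mk G := fun i => by
    have := Cardinal.card_typein_lt i hr
    rw [Ordinal.card_typein, hcard] at this
    exact this
  have hIic : ∀ i, Cardinal.mk {j | ¬ r i j} < Cardinal.mk G := fun i => by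
    have : {j | ¬ r i j} ⊆ {j | r j i} ∪ {i} := by
      intro j hj
      rcases trichotomous_of r j i with h | h | h
      · exact Or.inl h
      · exact Or.inr h
      · exact absurd h hj
    refine (Cardinal.mk_le_mk_of_subset this).trans_lt ((Cardinal.mk_union_le _ _).trans_lt
      (Cardinal.add_lt_of_lt hinf (hIio i) ?_))
    rw [Cardinal.mk_singleton]
    exact Cardinal.one_lt_aleph0.trans_le hinf
  let Fs : G × Bool → Set G := fun i => Prod.fst '' {j | ¬ r i j}
  have hFs : ∀ i, Cardinal.mk (Fs i) < Cardinal.mk G := fun i =>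
    Cardinal.mk_image_le.trans_lt (hIic i)
  have hmono : ∀ i j, r j i → Fs j ⊆ Fs i := by
    rintro i j hji _ ⟨k, hk, rfl⟩
    exact ⟨k, fun hik => hk (_root_.trans hji hik), rfl⟩
  have step : ∀ (i : G × Bool) (z : ∀ j, r j i → G), ∃ w : G, ∀ j (hj : r j i),
      ∀ a ∈ Fs i, ∀ b ∈ Fs j, a * w ≠ b * z j hj := by
    intro i z
    let T : Set G := (Fs i)⁻¹ * (Fs i * Set.range (fun j : {j | r j i} => z j.1 j.2))
    have hT : Cardinal.mk T < Cardinal.mk G := by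
      refine Cardinal.mk_mul_le.trans_lt (Cardinal.mul_lt_of_lt hinf ?_ ?_)
      · rw [Cardinal.mk_inv]; exact hFs i
      · refine Cardinal.mk_mul_le.trans_lt (Cardinal.mul_lt_of_lt hinf (hFs i) ?_)
        exact Cardinal.mk_range_le.trans_lt (hIio i)
    obtain ⟨w, hw⟩ : ∃ w, w ∉ T := by
      by_contra! hc
      rw [Set.eq_univ_of_forall hc, Cardinal.mk_univ] at hT
      exact lt_irrefl _ hT
    refine ⟨w, fun j hj a ha b hb hab => hw ?_⟩
    refine Set.mem_mul.2 ⟨a⁻¹, Set.inv_mem_inv.2 ha, b * z j hj,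
      Set.mul_mem_mul (hmono i j hj hb) ⟨⟨j, hj⟩, rfl⟩, ?_⟩
    rw [← hab, inv_mul_cancel_left]
  choose w hw using step
  let z : G × Bool → G := (wo.wf).fix w
  have hz : ∀ i j, r j i → ∀ a ∈ Fs i, ∀ b ∈ Fs j, a * z i ≠ b * z j := by
    intro i j hj a ha b hb
    have := hw i (fun j _ => z j) j hj a ha b hb
    have e : z i = w i (fun j _ => z j) := (wo.wf).fix_eq w i
    rwa [e]
  have hdis : ∀ i j, i ≠ j → ∀ a ∈ Fs i, ∀ b ∈ Fs j, a * z i ≠ b * z j := by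
    intro i j hij a ha b hb
    rcases trichotomous_of r i j with h | h | h
    · exact (hz j i h b hb a ha).symm
    · exact absurd h hij
    · exact hz i j h a ha b hb
  have hcof : ∀ (c : Bool) (F : Set G), Cardinal.mk F < Cardinal.mk G →
      ∃ g : G, F ⊆ Fs (g, c) := by
    intro c F hF
    have h1 : Cardinal.mk (⋃ f ∈ F, {j | r j (f, true)}) < Cardinal.mk G :=
      (Cardinal.card_biUnion_lt_iff_forall_of_isRegular h hF).2 fun f _ => hIio _
    obtain ⟨g, hg⟩ : ∃ g : G, (g, c) ∉ ⋃ f ∈ F, {j | r j (f, true)} := by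
      by_contra! hc
      have : Cardinal.mk G ≤ Cardinal.mk (⋃ f ∈ F, {j | r j (f, true)}) :=
        Cardinal.mk_le_of_injective (f := fun g => ⟨(g, c), hc g⟩) (by
          intro a b hab
          simpa using hab)
      exact absurd h1 this.not_gt
    refine ⟨g, fun f hf => ⟨(f, true), ?_, rfl⟩⟩
    intro hr'
    exact hg (Set.mem_biUnion hf hr')
  refine ⟨{x | ∃ g, ∃ a ∈ Fs (g, true), x = a * z (g, true)}, ?_, ?_⟩
  · intro F hF
    obtain ⟨g, hg⟩ := hcof true F hF
    exact ⟨z (g, true), fun f hf => ⟨g, f, hg hf, rfl⟩⟩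
  · intro F hF
    obtain ⟨g, hg⟩ := hcof false F hF
    refine ⟨z (g, false), fun f hf => ?_⟩
    rintro ⟨g', a, ha, he⟩
    exact hdis (g, false) (g', true) (by simp) f (hg hf) a ha he

theorem exists_thick_free {G : Type u} [Group G] [Infinite G]
    (hreg : ¬ (Cardinal.mk G).IsRegular) {S : Type u} (e : G ≃* FreeGroup S) :
    ∃ A : Set G, ThickSet A ∧ ThickSet Aᶜ := by
  classical
  have hG : Cardinal.mk G = Cardinal.mk (FreeGroup S) := Cardinal.mk_congr e.toEquiv
  have hne : Nonempty S := by
    by_contra hc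
    rw [not_nonempty_iff] at hc
    have : Infinite (FreeGroup S) := Infinite.of_injective e e.injective
    exact not_finite (FreeGroup S)
  rw [Cardinal.mk_freeGroup] at hG
  have hS : Cardinal.mk G = Cardinal.mk S := by
    rcases max_cases (Cardinal.mk S) Cardinal.aleph0 with ⟨h, _⟩ | ⟨h, _⟩
    · rw [hG, h]
    · rw [h] at hG
      exact absurd (hG ▸ Cardinal.isRegular_aleph0) hreg
  have key : ∀ (c : Bool) (F : Set G), Cardinal.mk F < Cardinal.mk G →
      ∃ s : S, ∀ f ∈ F,
        (e (f * e.symm (FreeGroup.mk [(s, c)]))).toWord.getLast? = some (s, c) := by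
    intro c F hF
    obtain ⟨s0⟩ := hne
    let l : G → S := fun g => ((e g).toWord.getLast?.getD (s0, true)).1
    have h1 : Cardinal.mk (l '' F) < Cardinal.mk S := hS ▸ Cardinal.mk_image_le.trans_lt hF
    obtain ⟨s, hs⟩ : ∃ s, s ∉ l '' F := by
      by_contra! hc
      rw [Set.eq_univ_of_forall hc, Cardinal.mk_univ] at h1
      exact lt_irrefl _ h1
    refine ⟨s, fun f hf => ?_⟩
    have hred : FreeGroup.IsReduced ((e f).toWord ++ [(s, c)]) := by
      refine List.IsChain.append FreeGroup.isReduced_toWord (List.isChain_singleton _) ?_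
      intro x hx y hy hxy
      exfalso
      simp only [List.head?_cons, Option.mem_def, Option.some.injEq] at hy
      subst hy
      refine hs ⟨f, hf, ?_⟩
      have hx' : (e f).toWord.getLast? = some x := hx
      simp only [l, hx', Option.getD_some]
      exact hxy
    rw [map_mul, MulEquiv.apply_symm_apply, FreeGroup.toWord_mul, FreeGroup.toWord_mk,
      FreeGroup.reduce_singleton, hred.reduce_eq]
    simp
  refine ⟨{g | ∃ s, (e g).toWord.getLast? = some (s, true)}, ?_, ?_⟩
  · intro F hF
    obtain ⟨s, hs⟩ := key true F hF
    exact ⟨_, fun f hf => ⟨s, hs f hf⟩⟩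
  · intro F hF
    obtain ⟨s, hs⟩ := key false F hF
    refine ⟨e.symm (FreeGroup.mk [(s, false)]), fun f hf => ?_⟩
    rintro ⟨s', hs'⟩
    rw [hs f hf] at hs'
    simp at hs'

/-- An infinite group `G` of cardinality `κ` such that `κ` is regular or `G` is a
free group admits no maximal left invariant `κ`-bounded topology. -/
theorem no_maximal_left_invariant_kappa_bounded_topology
    {G : Type u} [Group G] [Infinite G]
    (h : (Cardinal.mk G).IsRegular ∨ ∃ S : Type u, Nonempty (G ≃* FreeGroup S)) :
    ¬ ∃ τ : TopologicalSpace G,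
        (∀ g : G, @Continuous G G τ τ (fun x => g * x)) ∧
        (∀ x : G, ¬ @IsOpen G τ {x}) ∧
        (∀ U : Set G, @IsOpen G τ U → U.Nonempty →
          LeftKLarge (Cardinal.mk G) U) ∧
        (∀ τ' : TopologicalSpace G, τ' < τ → ∃ x : G, @IsOpen G τ' {x}) := by
  have hA : ∃ A : Set G, ThickSet A ∧ ThickSet Aᶜ := by
    by_cases hr : (Cardinal.mk G).IsRegular
    · exact exists_thick_regular hr
    · rcases h with h | ⟨S, ⟨e⟩⟩
      · exact absurd h hr
      · exact exists_thick_free hr e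
  obtain ⟨A, hA, hA'⟩ := hA
  rintro ⟨τ, -, hiso, hbd, hmax⟩
  let τ' : TopologicalSpace G :=
    { IsOpen := fun W => ∃ U V, IsOpen[τ] U ∧ IsOpen[τ] V ∧ W = (U ∩ A) ∪ V
      isOpen_univ := ⟨∅, Set.univ, @isOpen_empty _ τ, @isOpen_univ _ τ, by simp⟩
      isOpen_inter := by
        rintro _ _ ⟨U, V, hU, hV, rfl⟩ ⟨U', V', hU', hV', rfl⟩
        refine ⟨(U ∩ U') ∪ (U ∩ V') ∪ (V ∩ U'), V ∩ V', ?_, hV.inter hV', ?_⟩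
        · exact ((hU.inter hU').union (hU.inter hV')).union (hV.inter hU')
        · ext x; simp only [Set.mem_inter_iff, Set.mem_union]; tauto
      isOpen_sUnion := by
        intro s hs
        choose! U V hU hV he using hs
        refine ⟨⋃ t ∈ s, U t, ⋃ t ∈ s, V t, ?_, ?_, ?_⟩
        · exact @isOpen_biUnion _ _ τ _ _ hU
        · exact @isOpen_biUnion _ _ τ _ _ hV
        · ext x
          simp only [Set.mem_sUnion, Set.mem_union, Set.mem_inter_iff, Set.mem_iUnion]
          constructor
          · rintro ⟨t, ht, hx⟩
            rw [he t ht] at hx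
            rcases hx with hx | hx
            · exact Or.inl ⟨⟨t, ht, hx.1⟩, hx.2⟩
            · exact Or.inr ⟨t, ht, hx⟩
          · rintro (⟨⟨t, ht, hx⟩, hxA⟩ | ⟨t, ht, hx⟩)
            · exact ⟨t, ht, by rw [he t ht]; exact Or.inl ⟨hx, hxA⟩⟩
            · exact ⟨t, ht, by rw [he t ht]; exact Or.inr hx⟩ }
  have hle : τ' ≤ τ := fun U hU => ⟨∅, U, @isOpen_empty _ τ, hU, by simp⟩
  have hlt : τ' < τ := by
    refine lt_of_le_of_ne hle fun heq => ?_
    have hAo : IsOpen[τ'] A := ⟨Set.univ, ∅, @isOpen_univ _ τ, @isOpen_empty _ τ, by simp⟩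
    rw [heq] at hAo
    obtain ⟨y, hy⟩ := hA {1} (by
      rw [Cardinal.mk_singleton]
      exact Cardinal.one_lt_aleph0.trans_le (Cardinal.aleph0_le_mk G))
    exact hA'.not_large disjoint_compl_left (hbd A hAo ⟨_, hy 1 rfl⟩)
  obtain ⟨x, U, V, hU, hV, he⟩ := hmax τ' hlt
  have hVe : V = ∅ := by
    by_contra hne
    have hsub : V ⊆ {x} := he ▸ Set.subset_union_right
    have : V = {x} := (Set.subset_singleton_iff_eq.1 hsub).resolve_left hne
    exact hiso x (this ▸ hV)
  rw [hVe, Set.union_empty] at he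
  have hxU : x ∈ U := (he ▸ Set.mem_singleton x : x ∈ U ∩ A).1
  refine (hA.diff_singleton x).not_large ?_ (hbd U hU ⟨x, hxU⟩)
  refine Set.disjoint_left.2 fun y hy hyU => hy.2 ?_
  rw [he]
  exact ⟨hyU, hy.1⟩
end

section
/- Every Abelian group G of singular cardinality κ admits a maximal left invariant κ-bounded topology; that is, there exists a topology τ on G such that every left shift x ↦ gx is τ-continuous, τ has no isolated points, every nonempty τ-open set is left κ-large, and every topology on G strictly finer than τ has an isolated point. -/
open Pointwise

section Helpers

theorem LeftKLarge.mono' {G : Type*} [Group G] {k : Cardinal} {A B : Set G}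
    (h : LeftKLarge k A) (hAB : A ⊆ B) : LeftKLarge k B := by
  obtain ⟨F, hF, hA⟩ := h
  refine ⟨F, hF, (Set.eq_univ_of_univ_subset ?_).symm⟩
  rw [hA]
  exact Set.mul_subset_mul_left hAB

theorem LeftKLarge.of_mul {G : Type*} [Group G] {k : Cardinal} (hk : Cardinal.aleph0 ≤ k)
    {A F : Set G} (hF : Cardinal.mk F < k) (h : LeftKLarge k (F * A)) : LeftKLarge k A := by
  obtain ⟨F', hF', hA⟩ := h
  refine ⟨F' * F, Cardinal.mk_mul_le.trans_lt (Cardinal.mul_lt_of_lt hk hF' hF), ?_⟩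
  rw [hA, mul_assoc]

theorem LeftKLarge.of_thick {G : Type*} [CommGroup G] [Infinite G]
    (hsing : (Cardinal.mk G).ord.cof < Cardinal.mk G) {A : Set G}
    (h : ∀ F : Set G, Cardinal.mk F < Cardinal.mk G → ∃ g, ∀ x ∈ F, x * g ∈ A) :
    LeftKLarge (Cardinal.mk G) A := by
  have hk : Cardinal.aleph0 ≤ Cardinal.mk G := Cardinal.aleph0_le_mk G
  obtain ⟨s, hs, hcard⟩ := Order.exists_cof_eq (Cardinal.mk G).ord.ToType
  rw [Ordinal.cof_toType] at hcard
  have e : (Cardinal.mk G).ord.ToType ≃ G := by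
    apply Classical.choice
    apply Cardinal.eq.1
    simp
  have key : ∀ b : (Cardinal.mk G).ord.ToType, ∃ g, ∀ a ≤ b, e a * g ∈ A := by
    intro b
    obtain ⟨g, hg⟩ := h (e '' (insert b (Set.Iio b))) (by
      refine Cardinal.mk_image_le.trans_lt (Cardinal.mk_insert_le.trans_lt ?_)
      refine Cardinal.add_lt_of_lt hk ?_ (Cardinal.one_lt_aleph0.trans_le hk)
      have := Cardinal.mk_Iio_lt b (by simp)
      simpa using this)
    refine ⟨g, fun a ha => hg _ ⟨a, ?_, rfl⟩⟩
    rcases ha.eq_or_lt with h | h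
    · exact Or.inl h
    · exact Or.inr h
  choose g hg using key
  refine ⟨(fun b => (g b)⁻¹) '' s, Cardinal.mk_image_le.trans_lt (hcard ▸ hsing), ?_⟩
  refine (Set.eq_univ_of_forall fun x => ?_).symm
  obtain ⟨b, hb, hab⟩ := hs (e.symm x)
  refine ⟨(g b)⁻¹, ⟨b, hb, rfl⟩, x * g b, ?_, ?_⟩
  · simpa using hg b _ hab
  · simp

theorem LeftKLarge.compl_of_not {G : Type*} [CommGroup G] [Infinite G]
    (hsing : (Cardinal.mk G).ord.cof < Cardinal.mk G) {A : Set G}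
    (h : ¬ LeftKLarge (Cardinal.mk G) A) : LeftKLarge (Cardinal.mk G) Aᶜ := by
  apply LeftKLarge.of_thick hsing
  intro F hF
  by_contra! hc
  refine h ⟨F⁻¹, by rwa [Cardinal.mk_inv], (Set.eq_univ_of_forall fun g => ?_).symm⟩
  obtain ⟨x, hx, hxg⟩ := hc g
  exact ⟨x⁻¹, by simpa using hx, x * g, by simpa using hxg, by simp⟩

theorem LeftKLarge.diff {G : Type*} [CommGroup G] [Infinite G]
    (hsing : (Cardinal.mk G).ord.cof < Cardinal.mk G) {A B : Set G}
    (hA : LeftKLarge (Cardinal.mk G) A)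
    (hB : ¬ LeftKLarge (Cardinal.mk G) B) : LeftKLarge (Cardinal.mk G) (A \ B) := by
  have hk : Cardinal.aleph0 ≤ Cardinal.mk G := Cardinal.aleph0_le_mk G
  obtain ⟨F, hF, hFA⟩ := hA
  have h1 : ¬ LeftKLarge (Cardinal.mk G) (F * B) := fun h => hB (h.of_mul hk hF)
  refine LeftKLarge.of_mul hk hF ((LeftKLarge.compl_of_not hsing h1).mono' ?_)
  intro x hx
  have hx' : x ∈ F * A := hFA ▸ Set.mem_univ x
  obtain ⟨f, hf, a, ha, rfl⟩ := hx'
  exact ⟨f, hf, a, ⟨ha, fun hb => hx ⟨f, hf, a, hb, rfl⟩⟩, rfl⟩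

attribute [local instance] Ultrafilter.mul Ultrafilter.semigroup

theorem exists_idem_large {G : Type*} [CommGroup G] [Infinite G]
    (hsing : (Cardinal.mk G).ord.cof < Cardinal.mk G) :
    ∃ p : Ultrafilter G, (∀ A ∈ p, LeftKLarge (Cardinal.mk G) A) ∧
      ∀ A : Set G, A ∈ p ↔ {x | {y | x * y ∈ A} ∈ p} ∈ p := by
  have hk : Cardinal.aleph0 ≤ Cardinal.mk G := Cardinal.aleph0_le_mk G
  have huniv : LeftKLarge (Cardinal.mk G) (Set.univ : Set G) :=
    ⟨{1}, by simpa using Cardinal.one_lt_aleph0.trans_le hk, by simp⟩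
  let S : Set (Ultrafilter G) := {p | ∀ A ∈ p, LeftKLarge (Cardinal.mk G) A}
  have hclosed : IsClosed S := by
    have : S = ⋂ A ∈ {A : Set G | ¬ LeftKLarge (Cardinal.mk G) A}, {p : Ultrafilter G | Aᶜ ∈ p} := by
      ext p
      simp only [S, Set.mem_ofPred_eq, Set.mem_iInter, Ultrafilter.compl_mem_iff_notMem]
      exact forall_congr' fun A => ⟨fun h h1 h2 => h1 (h h2), fun h h1 => by
        by_contra h2; exact h h2 h1⟩
    rw [this]
    exact isClosed_biInter fun A _ => ultrafilter_isClosed_basic _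
  have hne : S.Nonempty := by
    let F : Filter G :=
      { sets := {A | ¬ LeftKLarge (Cardinal.mk G) Aᶜ}
        univ_sets := by
          rintro ⟨F, hF, h⟩
          simp at h
        sets_of_superset := fun {A B} hA hAB h =>
          hA (h.mono' (Set.compl_subset_compl.2 hAB))
        inter_sets := fun {A B} hA hB h => by
          refine hB ((LeftKLarge.diff hsing h hA).mono' ?_)
          intro x hx
          by_contra h
          exact hx.1 ⟨by by_contra h'; exact hx.2 h', by simpa using h⟩ }
    have hF : F.NeBot := by
      refine ⟨fun h => ?_⟩
      have : (∅ : Set G) ∈ F := by rw [h]; trivial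
      exact this (by simpa using huniv)
    refine ⟨Ultrafilter.of F, fun A hA => ?_⟩
    by_contra hl
    have : Aᶜ ∈ F := by
      change ¬ LeftKLarge (Cardinal.mk G) Aᶜᶜ
      rwa [compl_compl]
    have h2 : Aᶜ ∈ Ultrafilter.of F := Ultrafilter.of_le F this
    exact Ultrafilter.compl_mem_iff_notMem.1 h2 hA
  obtain ⟨p, hp, hpp⟩ := exists_idempotent_in_compact_subsemigroup
    (M := Ultrafilter G) Ultrafilter.continuous_mul_left S hne hclosed.isCompact (by
      intro p _ q hq A hA
      have hA' : {x | {y | x * y ∈ A} ∈ q} ∈ p := hA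
      obtain ⟨x, hx⟩ := p.nonempty_of_mem hA'
      refine LeftKLarge.of_mul (F := {x⁻¹}) hk
        (by simpa using Cardinal.one_lt_aleph0.trans_le hk) ((hq _ hx).mono' ?_)
      intro y hy
      exact ⟨x⁻¹, rfl, x * y, hy, by simp⟩)
  refine ⟨p, hp, fun A => ?_⟩
  have : A ∈ p ↔ A ∈ p * p := by rw [hpp]
  exact this

end Helpers

/-- Every Abelian group `G` of singular cardinality `κ` admits a maximal left
invariant `κ`-bounded topology. -/
theorem abelian_singular_maximal_left_invariant_kappa_bounded_topology
    {G : Type*} [CommGroup G] [Infinite G]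
    (hsing : (Cardinal.mk G).ord.cof < Cardinal.mk G) :
    ∃ τ : TopologicalSpace G,
      (∀ g : G, @Continuous G G τ τ (fun x => g * x)) ∧
      (∀ x : G, ¬ @IsOpen G τ {x}) ∧
      (∀ U : Set G, @IsOpen G τ U → U.Nonempty →
        LeftKLarge (Cardinal.mk G) U) ∧
      (∀ τ' : TopologicalSpace G, τ' < τ → ∃ x : G, @IsOpen G τ' {x}) := by
  have hk : Cardinal.aleph0 ≤ Cardinal.mk G := Cardinal.aleph0_le_mk G
  obtain ⟨p, hp, hpp⟩ := exists_idem_large hsing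
  let τ : TopologicalSpace G :=
    { IsOpen := fun U => ∀ x ∈ U, {y | x * y ∈ U} ∈ p
      isOpen_univ := by
        intro x _
        exact Filter.mem_of_superset Filter.univ_mem fun y _ => Set.mem_univ _
      isOpen_inter := by
        intro U V hU hV x hx
        exact Filter.inter_mem (hU x hx.1) (hV x hx.2)
      isOpen_sUnion := by
        rintro S hS x ⟨U, hU, hx⟩
        exact Filter.mem_of_superset (hS U hU x hx) fun y hy => ⟨U, hU, hy⟩ }
  have hlarge : ∀ U : Set G, @IsOpen G τ U → U.Nonempty → LeftKLarge (Cardinal.mk G) U := by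
    rintro U hU ⟨x, hx⟩
    refine LeftKLarge.of_mul (F := {x⁻¹}) hk
        (by simpa using Cardinal.one_lt_aleph0.trans_le hk) ((hp _ (hU x hx)).mono' ?_)
    intro y hy
    exact ⟨x⁻¹, rfl, x * y, hy, by simp⟩
  refine ⟨τ, ?_, ?_, hlarge, ?_⟩
  · intro g
    refine @Continuous.mk G G τ τ _ ?_
    intro U hU x hx
    have := hU (g * x) hx
    simpa [mul_assoc] using this
  · intro x hx
    obtain ⟨F, hF, h⟩ := hlarge _ hx ⟨x, rfl⟩
    have h1 : Cardinal.mk (Set.univ : Set G) ≤ Cardinal.mk F * Cardinal.mk ({x} : Set G) := by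
      rw [h]; exact Cardinal.mk_mul_le
    simp at h1
    exact absurd hF (not_lt.2 h1)
  · intro τ' hlt
    have hle : ∀ U, @IsOpen G τ U → @IsOpen G τ' U := fun U hU => hlt.le U hU
    have hnot : ∃ U, @IsOpen G τ' U ∧ ¬ @IsOpen G τ U := by
      by_contra! hc
      exact hlt.not_ge fun U hU => hc U hU
    obtain ⟨U, hU', hU⟩ := hnot
    have hU2 : ¬ ∀ x ∈ U, {y | x * y ∈ U} ∈ p := hU
    push Not at hU2
    obtain ⟨x, hxU, hx⟩ := hU2
    have hA : {y | x * y ∉ U} ∈ p := Ultrafilter.compl_mem_iff_notMem.2 hx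
    let A : Set G := {y | x * y ∉ U}
    let B : Set G := {y | y ∈ A ∧ {w | y * w ∈ A} ∈ p}
    have hB : B ∈ p := Filter.inter_mem hA ((hpp A).1 hA)
    have hBB : ∀ y ∈ B, {z | y * z ∈ B} ∈ p := by
      rintro y ⟨_, hy⟩
      refine Filter.mem_of_superset (Filter.inter_mem hy ((hpp _).1 hy)) ?_
      rintro z ⟨h1, h2⟩
      refine ⟨h1, ?_⟩
      simpa [mul_assoc] using h2
    let W : Set G := {z | z = x ∨ x⁻¹ * z ∈ B}
    have hW : @IsOpen G τ W := by
      rintro z (rfl | hz)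
      · refine Filter.mem_of_superset hB fun y hy => Or.inr ?_
        simpa using hy
      · refine Filter.mem_of_superset (hBB _ hz) fun y hy => Or.inr ?_
        simpa [mul_assoc] using hy
    refine ⟨x, ?_⟩
    have hUW : U ∩ W = {x} := by
      ext z
      constructor
      · rintro ⟨hz, rfl | h⟩
        · rfl
        · have := h.1
          simp [A] at this
          exact absurd hz this
      · rintro rfl
        exact ⟨hxU, Or.inl rfl⟩
    rw [← hUW]
    exact τ'.isOpen_inter U W hU' (hle W hW)
end

section
/- Let G be an infinite group and let μ(G) be the minimal cardinal number of cells of a partition of G into thin subsets. If |G| is a limit cardinal then μ(G) = |G|, and if |G| = γ⁺ is a successor cardinal then μ(G) = γ. -/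
open Pointwise

/-- `A` is thin: `gA ∩ A` is finite for every `g ≠ e`. -/
def ThinSet {G : Type*} [Group G] (A : Set G) : Prop :=
  ∀ g : G, g ≠ 1 → (((fun x => g * x) '' A) ∩ A).Finite

/-- `μ(G)`: the minimal number of cells of a partition of `G` into thin subsets. -/
noncomputable def muThin (G : Type*) [Group G] : Cardinal :=
  sInf {c : Cardinal | ∃ P : Set (Set G), ⋃₀ P = Set.univ ∧
    P.PairwiseDisjoint id ∧ (∀ A ∈ P, ThinSet A) ∧ Cardinal.mk P = c}

theorem muThin_lower {G : Type*} [Group G] [Infinite G] (P : Set (Set G))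
    (hU : ⋃₀ P = Set.univ) (hT : ∀ A ∈ P, ThinSet A) :
    ¬ Order.succ (Cardinal.mk P) < Cardinal.mk G := by
  intro hlt
  have h1 : ∀ x : G, ∃ A : P, x ∈ A.1 := by
    intro x
    have : x ∈ ⋃₀ P := hU ▸ Set.mem_univ x
    obtain ⟨A, hA, hx⟩ := this
    exact ⟨⟨A, hA⟩, hx⟩
  choose c hc using h1
  have hGinf : Cardinal.aleph0 ≤ Cardinal.mk G := Cardinal.aleph0_le_mk G
  have hP : Cardinal.mk P < Cardinal.mk G := (Order.lt_succ _).trans hlt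
  obtain ⟨S, hS⟩ := Cardinal.le_mk_iff_exists_set.1 hlt.le
  have h2 : ∀ x : G, ∃ p : (S × S) × P, p.1.1 ≠ p.1.2 ∧ c (p.1.1 * x) = p.2 ∧
      c (p.1.2 * x) = p.2 := by
    intro x
    by_contra hcon
    push Not at hcon
    have hinj : Function.Injective (fun a : S => c (a * x)) := by
      intro a b hab
      by_contra hne
      exact hcon ((a, b), c (a * x)) hne rfl hab.symm
    have := Cardinal.mk_le_of_injective hinj
    rw [hS] at this
    exact absurd (Order.lt_succ (Cardinal.mk P)) (not_lt.2 this)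
  choose p hp using h2
  have hcard : Cardinal.mk ((S × S) × P) < Cardinal.mk G := by
    rw [Cardinal.mk_prod, Cardinal.mk_prod]
    simp only [Cardinal.lift_id, hS]
    exact Cardinal.mul_lt_of_lt hGinf (Cardinal.mul_lt_of_lt hGinf hlt hlt) hP
  obtain ⟨⟨⟨a, b⟩, A⟩, hinf⟩ := Cardinal.exists_infinite_fiber p hcard
  have hinf' : (p ⁻¹' {((a, b), A)}).Infinite := Set.infinite_coe_iff.1 hinf
  obtain ⟨x0, hx0⟩ := hinf'.nonempty
  have hab : (a : G) ≠ b := by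
    have := (hp x0).1
    rw [show p x0 = ((a, b), A) from hx0] at this
    exact fun h => this (Subtype.ext h)
  have hfin := hT A.1 A.2 ((b : G) * (a : G)⁻¹)
    (fun h => hab (mul_inv_eq_one.1 h).symm)
  have himg : ((fun x => (b : G) * x) '' (p ⁻¹' {((a, b), A)})).Infinite :=
    hinf'.image (fun x _ y _ h => mul_left_cancel h)
  refine himg (hfin.subset ?_)
  rintro _ ⟨x, hx, rfl⟩
  have hpx := hp x
  rw [show p x = ((a, b), A) from hx] at hpx
  refine ⟨⟨(a : G) * x, ?_, by simp [mul_assoc]⟩, ?_⟩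
  · have e : c (a * x) = A := hpx.2.1
    exact e ▸ hc (a * x)
  · have e : c (b * x) = A := hpx.2.2
    exact e ▸ hc (b * x)

theorem muThin_closure_card {G : Type*} [Group G] (s : Set G) :
    Cardinal.mk (Subgroup.closure s) ≤ max (Cardinal.mk s) Cardinal.aleph0 := by
  rcases s.eq_empty_or_nonempty with rfl | hne
  · rw [Subgroup.closure_empty]
    simp
  · have := hne.to_subtype
    rw [← Cardinal.mk_freeGroup, FreeGroup.closure_eq_range]
    exact Cardinal.mk_le_of_surjective
      (FreeGroup.lift ((↑) : s → G)).rangeRestrict_surjective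

theorem muThin_rank {G : Type*} [Group G] [Infinite G] (γ : Cardinal)
    (h : Cardinal.mk G = Order.succ γ) (hγ : Cardinal.aleph0 ≤ γ) :
    ∃ r : G → (Cardinal.mk G).ord.ToType,
      (∀ x y, r (x * y) ≤ max (r x) (r y)) ∧ (∀ x, r x⁻¹ ≤ r x) ∧
      ∀ a, Cardinal.mk {x // r x = a} ≤ γ := by
  obtain ⟨f⟩ : Nonempty (G ≃ (Cardinal.mk G).ord.ToType) :=
    Cardinal.eq.1 (Cardinal.mk_ord_toType _).symm
  let H : (Cardinal.mk G).ord.ToType → Subgroup G := fun a => Subgroup.closure {b | f b ≤ a}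
  have hmono : ∀ a b, a ≤ b → H a ≤ H b := fun a b hab =>
    Subgroup.closure_mono (fun x hx => le_trans hx hab)
  have hex : ∀ x, ∃ a, x ∈ H a ∧ ∀ b, x ∈ H b → a ≤ b := by
    intro x
    have hne : {a | x ∈ H a}.Nonempty := ⟨f x, Subgroup.subset_closure (le_refl (f x))⟩
    exact ⟨WellFounded.min (wellFounded_lt) _ hne, WellFounded.min_mem _ _ hne,
      fun b hb => not_lt.1 (WellFounded.not_lt_min wellFounded_lt {a | x ∈ H a} hb)⟩
  choose r hr hr' using hex
  refine ⟨r, fun x y => hr' _ _ ?_, fun x => hr' _ _ ((H _).inv_mem (hr x)), fun a => ?_⟩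
  · exact (H _).mul_mem (hmono _ _ (le_max_left _ _) (hr x)) (hmono _ _ (le_max_right _ _) (hr y))
  · have h1 : Cardinal.mk {x // r x = a} ≤ Cardinal.mk (H a) :=
      Cardinal.mk_le_of_injective (f := fun x => (⟨x.1, hmono _ _ x.2.le (hr x.1)⟩ : H a))
        (fun x y hxy => Subtype.ext (by simpa using hxy))
    refine h1.trans ((muThin_closure_card _).trans (max_le ?_ hγ))
    have h2 : Cardinal.mk {b | f b ≤ a} ≤ Cardinal.mk (Set.Iic a) :=
      Cardinal.mk_le_of_injective (f := fun x => (⟨f x.1, x.2⟩ : Set.Iic a))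
        (fun x y hxy => Subtype.ext (f.injective (congrArg Subtype.val hxy)))
    refine h2.trans (Order.lt_succ_iff.1 ?_)
    rw [← h]
    have h3 := Cardinal.mk_Iic_lt a (by simp) (by simp [h, hγ.trans (Order.le_succ γ)])
    simpa using h3

theorem muThin_color {G : Type*} [Group G] [Infinite G] (γ : Cardinal)
    (h : Cardinal.mk G = Order.succ γ) (hγ : Cardinal.aleph0 ≤ γ) :
    ∃ P : Set (Set G), ⋃₀ P = Set.univ ∧
    P.PairwiseDisjoint id ∧ (∀ A ∈ P, ThinSet A) ∧ Cardinal.mk P ≤ γ := by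
  obtain ⟨r, hmul, hinv, hcard⟩ := muThin_rank γ h hγ
  have hex : ∀ a, ∃ φ : {x // r x = a} → γ.out, Function.Injective φ := by
    intro a
    have := hcard a
    rw [← Cardinal.mk_out γ] at this
    obtain ⟨e⟩ := this
    exact ⟨e, e.injective⟩
  choose φ hφ using hex
  let χ : G → γ.out := fun x => φ (r x) ⟨x, rfl⟩
  have hχ : ∀ x y, r x = r y → χ x = χ y → x = y := by
    intro x y hxy hc
    have key : ∀ a (hx : r x = a) (hy : r y = a), φ a ⟨x, hx⟩ = φ a ⟨y, hy⟩ → x = y :=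
      fun a hx hy he => congrArg Subtype.val (hφ a he)
    apply key (r y) hxy rfl
    rw [show φ (r y) ⟨y, rfl⟩ = χ y from rfl, ← hc]
    have : ∀ a (hx : r x = a), φ a ⟨x, hx⟩ = φ (r x) ⟨x, rfl⟩ := by
      rintro _ rfl; rfl
    exact this _ _
  refine ⟨Set.range (fun c => χ ⁻¹' {c}), ?_, ?_, ?_, ?_⟩
  · ext x; simp
  · rintro _ ⟨c, rfl⟩ _ ⟨d, rfl⟩ hne
    refine Set.disjoint_left.2 fun x hx hy => hne ?_
    have hx' : χ x = c := hx
    have hy' : χ x = d := hy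
    rw [← hx', ← hy']
  · rintro _ ⟨c, rfl⟩ g hg
    have hs : ({y | r y = r g ∧ χ y = c} : Set G).Subsingleton := fun x hx y hy =>
      hχ x y (hx.1.trans hy.1.symm) (hx.2.trans hy.2.symm)
    refine (hs.finite.union (hs.finite.image (fun x => g * x))).subset ?_
    rintro _ ⟨⟨x, hx, rfl⟩, hy⟩
    have hx' : χ x = c := hx
    have hy' : χ (g * x) = c := hy
    have hne : r x ≠ r (g * x) := by
      intro he
      have := hχ _ _ he (hx'.trans hy'.symm)
      exact hg (by simpa using this)
    have e1 := hmul g x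
    have e2 : r g ≤ max (r (g * x)) (r x) := by
      have := hmul (g * x) x⁻¹
      rw [mul_inv_cancel_right] at this
      exact this.trans (max_le_max le_rfl (hinv x))
    have e3 : r x ≤ max (r g) (r (g * x)) := by
      have := hmul g⁻¹ (g * x)
      rw [inv_mul_cancel_left] at this
      exact this.trans (max_le_max (hinv g) le_rfl)
    rcases lt_or_gt_of_ne hne with hlt | hlt
    · left
      refine ⟨le_antisymm ?_ ?_, hy'⟩
      · exact (le_max_iff.1 e1).resolve_right (not_le.2 hlt)
      · rwa [max_eq_left hlt.le] at e2
    · right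
      refine ⟨x, ⟨le_antisymm ?_ ?_, hx'⟩, rfl⟩
      · exact (le_max_iff.1 e3).resolve_right (not_le.2 hlt)
      · rwa [max_eq_right hlt.le] at e2
  · exact Cardinal.mk_range_le.trans (Cardinal.mk_out γ).le

/-- If `|G|` is a limit cardinal then `μ(G) = |G|`; if `|G| = γ⁺` then `μ(G) = γ`. -/
theorem muThin_eq {G : Type*} [Group G] [Infinite G] :
    (Order.IsSuccLimit (Cardinal.mk G) → muThin G = Cardinal.mk G) ∧
    (∀ γ : Cardinal, Cardinal.mk G = Order.succ γ → muThin G = γ) := by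
  have hsing : ∃ P : Set (Set G), ⋃₀ P = Set.univ ∧
      P.PairwiseDisjoint id ∧ (∀ A ∈ P, ThinSet A) ∧ Cardinal.mk P = Cardinal.mk G := by
    refine ⟨Set.range (fun x => {x}), by ext x; simp, ?_, ?_,
      Cardinal.mk_range_eq _ Set.singleton_injective⟩
    · rintro _ ⟨c, rfl⟩ _ ⟨d, rfl⟩ hne
      refine Set.disjoint_left.2 fun x hx hy => hne ?_
      have hx' : x = c := hx
      have hy' : x = d := hy
      rw [← hx', ← hy']
    · rintro _ ⟨c, rfl⟩ g hg
      exact (Set.finite_singleton c).subset Set.inter_subset_right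
  constructor
  · intro hlim
    refine le_antisymm (csInf_le' hsing) (le_csInf ⟨_, hsing⟩ ?_)
    rintro _ ⟨P, hU, -, hT, rfl⟩
    by_contra hcon
    exact muThin_lower P hU hT (hlim.succ_lt (not_le.1 hcon))
  · intro γ hγ
    have hinf : Cardinal.aleph0 ≤ γ := by
      by_contra hcon
      have h1 := Cardinal.isSuccLimit_aleph0.succ_lt (not_le.1 hcon)
      rw [← hγ] at h1
      exact absurd (Cardinal.aleph0_le_mk G) (not_le.2 h1)
    obtain ⟨P, hU, hD, hT, hc⟩ := muThin_color γ hγ hinf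
    have hle : muThin G ≤ Cardinal.mk P := csInf_le' ⟨P, hU, hD, hT, rfl⟩
    refine le_antisymm (hle.trans hc) (le_csInf ⟨_, hsing⟩ ?_)
    rintro _ ⟨P, hU, -, hT, rfl⟩
    by_contra hcon
    refine muThin_lower P hU hT ?_
    rw [hγ]
    exact Order.succ_lt_succ (not_le.1 hcon)
end

section
/- Let G be an infinite group, κ an infinite cardinal, and let η(G) be the minimal cardinal number of cells of a partition of G into sparse subsets. If |G| > (κ⁺)^{ℵ₀} then η(G) > κ, and if |G| ≤ κ⁺ then η(G) ≤ κ. -/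
open Pointwise

/-- `A` is sparse: every infinite `S ⊆ G` contains a nonempty finite `F ⊆ S`
such that `⋂_{g ∈ F} gA` is finite. -/
def SparseSet {G : Type*} [Group G] (A : Set G) : Prop :=
  ∀ S : Set G, S.Infinite → ∃ F : Set G, F ⊆ S ∧ F.Finite ∧ F.Nonempty ∧
    (⋂ g ∈ F, (fun x => g * x) '' A).Finite

/-- `η(G)`: the minimal number of cells of a partition of `G` into sparse subsets. -/
noncomputable def etaSparse (G : Type*) [Group G] : Cardinal :=
  sInf {c : Cardinal | ∃ P : Set (Set G), ⋃₀ P = Set.univ ∧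
    P.PairwiseDisjoint id ∧ (∀ A ∈ P, SparseSet A) ∧ Cardinal.mk P = c}

open Cardinal in
theorem eta_aux_lower {G : Type*} [Group G] [Infinite G]
    (kappa : Cardinal) (hkappa : Cardinal.aleph0 ≤ kappa)
    (h : (Order.succ kappa) ^ Cardinal.aleph0 < Cardinal.mk G)
    (P : Set (Set G)) (hU : ⋃₀ P = Set.univ) (hS : ∀ A ∈ P, SparseSet A)
    (hc : Cardinal.mk P ≤ kappa) : False := by
  have hk1 : Order.succ kappa ≤ (Order.succ kappa) ^ Cardinal.aleph0 :=
    Cardinal.self_le_power _ Cardinal.one_le_aleph0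
  have hks : kappa < Order.succ kappa := Order.lt_succ kappa
  have hT : #((Order.succ kappa).out) ≤ #G := by
    rw [Cardinal.mk_out]; exact hk1.trans h.le
  obtain ⟨i⟩ := hT
  have hex : ∀ x : G, ∃ q : (ℕ → (Order.succ kappa).out) × P,
      Function.Injective q.1 ∧ ∀ n, (i (q.1 n))⁻¹ * x ∈ (q.2 : Set G) := by
    intro x
    have hcol : ∀ g : G, ∃ p : P, g ∈ (p : Set G) := by
      intro g
      have : g ∈ ⋃₀ P := by rw [hU]; trivial
      obtain ⟨A, hA, hg⟩ := this
      exact ⟨⟨A, hA⟩, hg⟩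
    choose c hcc using hcol
    obtain ⟨p, hp⟩ := Cardinal.infinite_pigeonhole_card
      (fun t : (Order.succ kappa).out => c ((i t)⁻¹ * x)) (Order.succ kappa)
      (by rw [Cardinal.mk_out]) (hkappa.trans hks.le)
      ((hc.trans_lt hks).trans_le (Cardinal.isRegular_succ hkappa).2)
    have hinf : Set.Infinite ((fun t : (Order.succ kappa).out => c ((i t)⁻¹ * x)) ⁻¹' {p}) := by
      rw [← Set.infinite_coe_iff, Cardinal.infinite_iff]
      exact (hkappa.trans hks.le).trans hp
    refine ⟨(fun n => hinf.natEmbedding _ n, p), ?_, ?_⟩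
    · intro a b hab
      exact (hinf.natEmbedding _).injective (Subtype.ext hab)
    · intro n
      have := (hinf.natEmbedding _ n).2
      simp only [Set.mem_preimage, Set.mem_singleton_iff] at this
      have h2 := hcc ((i (hinf.natEmbedding _ n : _))⁻¹ * x)
      rw [this] at h2
      exact h2
  choose Φ hΦ1 hΦ2 using hex
  have hcod : #((ℕ → (Order.succ kappa).out) × P) ≤ (Order.succ kappa) ^ Cardinal.aleph0 := by
    rw [Cardinal.mk_prod, Cardinal.mk_arrow]
    simp only [Cardinal.mk_out, Cardinal.lift_id, Cardinal.mk_nat, Cardinal.lift_aleph0,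
      Cardinal.lift_uzero]
    exact Cardinal.mul_le_of_le ((hkappa.trans hks.le).trans hk1) le_rfl
      (hc.trans (hks.le.trans hk1))
  have hfib : ∃ a, Set.Infinite (Φ ⁻¹' {a}) := by
    obtain ⟨a, ha⟩ := Cardinal.infinite_pigeonhole_card Φ ((Order.succ ((Order.succ kappa) ^ Cardinal.aleph0)))
      (Order.succ_le_of_lt h) (((hkappa.trans hks.le).trans hk1).trans (Order.le_succ _))
      ((hcod.trans_lt (Order.lt_succ _)).trans_le
        (Cardinal.isRegular_succ ((hkappa.trans hks.le).trans hk1)).2)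
    refine ⟨a, ?_⟩
    rw [← Set.infinite_coe_iff, Cardinal.infinite_iff]
    exact (((hkappa.trans hks.le).trans hk1).trans (Order.le_succ _)).trans ha
  obtain ⟨a, ha⟩ := hfib
  obtain ⟨x0, hx0⟩ := ha.nonempty
  have hinj : Function.Injective a.1 := by
    have := hΦ1 x0
    rwa [show Φ x0 = a from hx0] at this
  have hSinf : Set.Infinite (Set.range (fun n => i (a.1 n))) :=
    Set.infinite_range_of_injective (i.injective.comp hinj)
  obtain ⟨F, hF, -, -, hfin⟩ := hS a.2 a.2.2 _ hSinf
  refine ha (hfin.subset ?_)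
  intro x hx
  simp only [Set.mem_iInter]
  intro g hg
  obtain ⟨n, rfl⟩ := hF hg
  refine ⟨(i (a.1 n))⁻¹ * x, ?_, by simp⟩
  have := hΦ2 x n
  rwa [show Φ x = a from hx] at this

theorem card_closure_aux {G : Type*} [Group G] (s : Set G) (kappa : Cardinal)
    (hkappa : Cardinal.aleph0 ≤ kappa) (hs : Cardinal.mk s ≤ kappa) :
    Cardinal.mk (Subgroup.closure s) ≤ kappa := by
  rw [FreeGroup.closure_eq_range]
  refine (Cardinal.mk_range_le (f := FreeGroup.lift ((↑) : s → G))).trans ?_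
  rcases isEmpty_or_nonempty s with h | h
  · have : Unique (FreeGroup s) := inferInstance
    exact (Cardinal.mk_eq_one (FreeGroup s)).le.trans (Cardinal.one_le_aleph0.trans hkappa)
  · rw [Cardinal.mk_freeGroup]
    exact max_le hs hkappa

/-- existence of the rank function -/
theorem exists_rank.{u} {G : Type u} [Group G] (kappa : Cardinal)
    (hkappa : Cardinal.aleph0 ≤ kappa) (hG : Cardinal.mk G ≤ Order.succ kappa) :
    ∃ r : G → Ordinal.{u}, (∀ x y, r (x * y) ≤ max (r x) (r y)) ∧ (∀ x, r x⁻¹ ≤ r x) ∧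
      ∀ a, Cardinal.mk {x | r x = a} ≤ kappa := by
  obtain ⟨R, hR, hRt⟩ := Cardinal.exists_ord_eq G
  let f : G → Ordinal := fun x => Ordinal.typein R x
  let H : Ordinal → Subgroup G := fun a => Subgroup.closure {x | f x ≤ a}
  have Hmono : Monotone H := fun a b hab => Subgroup.closure_mono fun x (hx : f x ≤ a) => show f x ≤ b from le_trans hx hab
  have hne : ∀ x, {a | x ∈ H a}.Nonempty := fun x => ⟨f x, Subgroup.subset_closure (show f x ≤ f x from le_rfl)⟩
  let r : G → Ordinal := fun x => sInf {a | x ∈ H a}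
  have hr : ∀ x, x ∈ H (r x) := fun x => csInf_mem (hne x)
  have hrle : ∀ x a, x ∈ H a → r x ≤ a := fun x a h => csInf_le' h
  have hrf : ∀ x, r x ≤ f x := fun x => hrle _ _ (Subgroup.subset_closure (show f x ≤ f x from le_rfl))
  refine ⟨r, ?_, ?_, ?_⟩
  · intro x y
    exact hrle _ _ (mul_mem (Hmono (le_max_left _ _) (hr x)) (Hmono (le_max_right _ _) (hr y)))
  · intro x
    exact hrle _ _ (inv_mem (hr x))
  · intro a
    rcases Set.eq_empty_or_nonempty {x | r x = a} with h | ⟨x, hx⟩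
    · rw [h]; simp
    · have h1 : {x | r x = a} ⊆ (H a : Set G) := by
        rintro y rfl
        exact hr y
      refine (Cardinal.mk_le_mk_of_subset h1).trans ?_
      refine card_closure_aux _ kappa hkappa ?_
      have h2 : {y | f y ≤ a} ⊆ insert x {y | R y x} := by
        intro y hy
        have : f y ≤ f x := le_trans hy (hx ▸ hrf x)
        rcases this.lt_or_eq with h | h
        · right; exact (Ordinal.typein_lt_typein R).1 h
        · left; exact Ordinal.typein_injective R h
      refine (Cardinal.mk_le_mk_of_subset h2).trans ?_
      refine (Cardinal.mk_insert_le).trans ?_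
      refine Cardinal.add_le_of_le hkappa ?_ (Cardinal.one_le_aleph0.trans hkappa)
      rw [← Order.lt_succ_iff]
      exact lt_of_lt_of_le (Cardinal.card_typein_lt x hRt) hG

def GoodFor {G : Type*} [Group G] (A S : Set G) : Prop :=
  ∃ F : Set G, F ⊆ S ∧ F.Finite ∧ F.Nonempty ∧ {x | ∀ g ∈ F, g⁻¹ * x ∈ A}.Finite

theorem GoodFor.mono {G : Type*} [Group G] {A S T : Set G} (h : GoodFor A S) (hST : S ⊆ T) :
    GoodFor A T := by
  obtain ⟨F, h1, h2⟩ := h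
  exact ⟨F, h1.trans hST, h2⟩

theorem GoodFor.translate {G : Type*} [Group G] {A S : Set G} (g : G)
    (h : GoodFor A ((fun x => g * x) ⁻¹' S)) : GoodFor A S := by
  obtain ⟨F, h1, h2, h3, h4⟩ := h
  refine ⟨(fun x => g * x) '' F, by rintro _ ⟨y, hy, rfl⟩; exact h1 hy, h2.image _, h3.image _, ?_⟩
  refine (h4.image (fun x => g * x)).subset ?_
  intro x hx
  refine ⟨g⁻¹ * x, ?_, by simp⟩
  intro y hy
  have := hx _ ⟨y, hy, rfl⟩
  simpa [mul_assoc] using this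

theorem sparse_of_good {G : Type*} [Group G] {A : Set G}
    (h : ∀ S : Set G, S.Infinite → GoodFor A S) : SparseSet A := by
  intro S hS
  obtain ⟨F, h1, h2, h3, h4⟩ := h S hS
  refine ⟨F, h1, h2, h3, h4.subset ?_⟩
  intro x hx g hg
  simp only [Set.mem_iInter] at hx
  obtain ⟨y, hy, rfl⟩ := hx g hg
  simpa using hy

theorem three_of_infinite {α : Type*} [LinearOrder α] {s : Set α} (hs : s.Infinite) :
    ∃ a ∈ s, ∃ b ∈ s, ∃ c ∈ s, a < b ∧ b < c := by
  obtain ⟨t, hts, htc⟩ := hs.exists_subset_card_eq 3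
  let e := t.orderEmbOfFin htc
  have he : ∀ i, e i ∈ s := fun i => hts (t.orderEmbOfFin_mem htc i)
  exact ⟨e 0, he 0, e 1, he 1, e 2, he 2, e.strictMono (by decide), e.strictMono (by decide)⟩

theorem rank_sparse {G : Type*} [Group G] (r : G → Ordinal)
    (hmul : ∀ x y, r (x * y) ≤ max (r x) (r y)) (hinv : ∀ x, r x⁻¹ ≤ r x) (A : Set G)
    (hA : ∀ x ∈ A, ∀ y ∈ A, r x = r y → x = y) : SparseSet A := by
  -- translation does not change large ranks
  have hbig : ∀ g x, r g < r x → r (g⁻¹ * x) = r x := by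
    intro g x h
    apply le_antisymm
    · exact (hmul _ _).trans (max_le ((hinv g).trans h.le) le_rfl)
    · have := hmul g (g⁻¹ * x)
      rw [mul_inv_cancel_left] at this
      rcases le_max_iff.1 this with h1 | h1
      · exact absurd h1 (not_le.2 h)
      · exact h1
  have hbig2 : ∀ g x, r x < r g → r (g⁻¹ * x) = r g := by
    intro g x h
    have hge : r g ≤ r (g⁻¹ * x) := by
      have h1 := hmul x (g⁻¹ * x)⁻¹
      rw [mul_inv_rev, inv_inv, mul_inv_cancel_left] at h1
      rcases le_max_iff.1 h1 with h2 | h2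
      · exact absurd h2 (not_le.2 h)
      · have h3 := hinv (g⁻¹ * x)
        rw [mul_inv_rev, inv_inv] at h3
        exact h2.trans h3
    exact le_antisymm ((hmul _ _).trans (max_le (hinv g) h.le)) hge
  have htwo : ∀ g h x, g ≠ h → g⁻¹ * x ∈ A → h⁻¹ * x ∈ A → r (g⁻¹ * x) = r (h⁻¹ * x) → False := by
    intro g h x hne h1 h2 h3
    have := hA _ h1 _ h2 h3
    exact hne (inv_injective (mul_right_cancel this))
  -- no infinite constant rank part
  have hinc : ∀ S : Set G, S.Infinite → (∀ a, ¬ (S ∩ {x | r x = a}).Infinite) → GoodFor A S := by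
    intro S hS hfin
    have him : (r '' S).Infinite := by
      intro hf
      apply hS
      refine (hf.biUnion (t := fun a => S ∩ {x | r x = a})
        (fun a _ => Set.not_infinite.1 (hfin a))).subset ?_
      intro x hx
      simp only [Set.mem_iUnion]
      exact ⟨r x, ⟨x, hx, rfl⟩, hx, rfl⟩
    obtain ⟨_, ⟨g1, hg1, rfl⟩, _, ⟨g2, hg2, rfl⟩, _, ⟨g3, hg3, rfl⟩, h12, h23⟩ :=
      three_of_infinite him
    refine ⟨{g1, g2, g3}, ?_, Set.toFinite _, ⟨g1, by simp⟩, ?_⟩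
    · rintro x (rfl | rfl | rfl) <;> assumption
    · apply Set.Subsingleton.finite
      have key : ∀ x, (∀ g ∈ ({g1, g2, g3} : Set G), g⁻¹ * x ∈ A) → r (g3⁻¹ * x) = r g3 := by
        intro x hx
        apply hbig2
        by_contra hlt
        have hx2 : r g2 < r x := h23.trans_le (not_lt.1 hlt)
        refine htwo g1 g2 x ?_ (hx _ (by simp)) (hx _ (by simp)) ?_
        · rintro rfl; exact lt_irrefl _ h12
        · rw [hbig _ _ hx2, hbig _ _ (h12.trans hx2)]
      intro x hx y hy
      have := hA _ (hx g3 (by simp)) _ (hy g3 (by simp)) ((key x hx).trans (key y hy).symm)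
      exact mul_left_cancel this
  -- constant rank
  have hconst : ∀ a : Ordinal, ∀ S : Set G, S.Infinite → (∀ x ∈ S, r x = a) → GoodFor A S := by
    intro a
    induction a using WellFoundedLT.induction with
    | ind a ih =>
    intro S hS hSa
    by_cases hcos : ∃ g ∈ S, (S ∩ {x | r (g⁻¹ * x) < a}).Infinite
    · obtain ⟨g, hg, hinf⟩ := hcos
      apply GoodFor.translate g
      set T : Set G := (fun x => g * x) ⁻¹' (S ∩ {x | r (g⁻¹ * x) < a}) with hT
      have hTS : T ⊆ (fun x => g * x) ⁻¹' S := fun x hx => hx.1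
      have hTinf : T.Infinite := by
        apply hinf.preimage
        intro x _
        exact ⟨g⁻¹ * x, by simp⟩
      have hTa : ∀ x ∈ T, r x < a := by
        intro x hx
        have := hx.2
        simpa using this
      apply GoodFor.mono _ hTS
      by_cases hc : ∃ b, (T ∩ {x | r x = b}).Infinite
      · obtain ⟨b, hb⟩ := hc
        obtain ⟨y, hy1, hy2⟩ := hb.nonempty
        have hba : b < a := by rw [← hy2]; exact hTa y hy1
        exact (ih b hba _ hb (fun x hx => hx.2)).mono Set.inter_subset_left
      · push Not at hc
        exact hinc T hTinf (fun b => Set.not_infinite.2 (hc b))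
    · push Not at hcos
      obtain ⟨g1, hg1⟩ := hS.nonempty
      have hS1 := hS.sdiff (hcos g1 hg1)
      obtain ⟨g2, hg2, hg21⟩ := (hS1.sdiff (Set.finite_singleton g1)).nonempty
      obtain ⟨g3, ⟨⟨hg3, hg32⟩, hg31⟩⟩ :=
        ((hS1.sdiff (hcos g2 hg2.1)).sdiff (Set.toFinite {g1, g2})).nonempty
      have n12 : g1 ≠ g2 := fun h => hg21 (by simp [h])
      have n13 : g1 ≠ g3 := fun h => hg31 (by simp [h])
      have n23 : g2 ≠ g3 := fun h => hg31 (by simp [h])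
      have c12 : ¬ r (g1⁻¹ * g2) < a := fun h => hg2.2 ⟨hg2.1, h⟩
      have c13 : ¬ r (g1⁻¹ * g3) < a := fun h => hg3.2 ⟨hg3.1, h⟩
      have c23 : ¬ r (g2⁻¹ * g3) < a := fun h => hg32 ⟨hg3.1, h⟩
      have hcl : ∀ g h x, r (g⁻¹ * x) < a → r (h⁻¹ * x) < a → r (g⁻¹ * h) < a := by
        intro g h x h1 h2
        have h3 := hmul (g⁻¹ * x) (h⁻¹ * x)⁻¹
        rw [show (g⁻¹ * x) * (h⁻¹ * x)⁻¹ = g⁻¹ * h by group] at h3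
        exact h3.trans_lt (max_lt h1 ((hinv _).trans_lt h2))
      have s1 := hSa g1 hg1
      have s2 := hSa g2 hg2.1
      have s3 := hSa g3 hg3.1
      refine ⟨{g1, g2, g3}, ?_, Set.toFinite _, ⟨g1, by simp⟩, ?_⟩
      · rintro x (rfl | rfl | rfl)
        · exact hg1
        · exact hg2.1
        · exact hg3.1
      · convert Set.finite_empty
        rw [Set.eq_empty_iff_forall_notMem]
        intro x hx
        have m1 := hx g1 (by simp)
        have m2 := hx g2 (by simp)
        have m3 := hx g3 (by simp)
        rcases lt_or_ge a (r x) with hlt | hle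
        · refine htwo g1 g2 x n12 m1 m2 ?_
          rw [hbig _ _ (s1 ▸ hlt), hbig _ _ (s2 ▸ hlt)]
        · have b : ∀ g, r g = a → r (g⁻¹ * x) < a ∨ r (g⁻¹ * x) = a := fun g hg =>
            lt_or_eq_of_le ((hmul _ _).trans (max_le ((hinv g).trans hg.le) hle))
          rcases b g1 s1 with b1 | b1 <;> rcases b g2 s2 with b2 | b2
          · exact c12 (hcl _ _ _ b1 b2)
          · rcases b g3 s3 with b3 | b3
            · exact c13 (hcl _ _ _ b1 b3)
            · exact htwo _ _ _ n23 m2 m3 (b2.trans b3.symm)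
          · rcases b g3 s3 with b3 | b3
            · exact c23 (hcl _ _ _ b2 b3)
            · exact htwo _ _ _ n13 m1 m3 (b1.trans b3.symm)
          · exact htwo _ _ _ n12 m1 m2 (b1.trans b2.symm)
  apply sparse_of_good
  intro S hS
  by_cases hc : ∃ b, (S ∩ {x | r x = b}).Infinite
  · obtain ⟨b, hb⟩ := hc
    exact (hconst b _ hb (fun x hx => hx.2)).mono Set.inter_subset_left
  · push Not at hc
    exact hinc S hS (fun b => Set.not_infinite.2 (hc b))

theorem eta_aux_upper {G : Type*} [Group G]
    (kappa : Cardinal) (hkappa : Cardinal.aleph0 ≤ kappa)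
    (hG : Cardinal.mk G ≤ Order.succ kappa) :
    etaSparse G ≤ kappa := by
  obtain ⟨r, hmul, hinv, hcard⟩ := exists_rank kappa hkappa hG
  have hemb : ∀ a, Nonempty ({x | r x = a} ↪ kappa.out) := by
    intro a
    have := hcard a
    rw [← Cardinal.mk_out kappa] at this
    exact this
  let e := fun a => (hemb a).some
  let c : G → kappa.out := fun x => e (r x) ⟨x, rfl⟩
  have hc : ∀ x y, r x = r y → c x = c y → x = y := by
    intro x y h1 h2
    have : ∀ a (hx : r x = a) (hy : r y = a), e a ⟨x, hx⟩ = e a ⟨y, hy⟩ → x = y := by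
      intro a hx hy h
      exact congrArg Subtype.val ((e a).injective h)
    apply this (r y) h1 rfl
    have h3 : ∀ a (hx : r x = a), e a ⟨x, hx⟩ = c x := by
      rintro a rfl; rfl
    rw [h3 _ h1, h2]
  have hmem : Cardinal.mk (Set.range (fun k => c ⁻¹' {k})) ∈ {c : Cardinal |
      ∃ P : Set (Set G), ⋃₀ P = Set.univ ∧
      P.PairwiseDisjoint id ∧ (∀ A ∈ P, SparseSet A) ∧ Cardinal.mk P = c} := by
    refine ⟨Set.range (fun k => c ⁻¹' {k}), ?_, ?_, ?_, rfl⟩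
    · rw [Set.eq_univ_iff_forall]
      intro x
      exact ⟨_, ⟨c x, rfl⟩, rfl⟩
    · rintro _ ⟨k, rfl⟩ _ ⟨l, rfl⟩ hkl
      simp only [Function.onFun, id]
      rw [Set.disjoint_left]
      intro x hx hy
      apply hkl
      have h1 : c x = k := hx
      have h2 : c x = l := hy
      rw [← h1, ← h2]
    · rintro _ ⟨k, rfl⟩
      refine rank_sparse r hmul hinv _ ?_
      intro x hx y hy h
      have h1 : c x = k := hx
      have h2 : c y = k := hy
      exact hc x y h (h1.trans h2.symm)
  exact (csInf_le' hmem).trans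
      (Cardinal.mk_range_le.trans (Cardinal.mk_out kappa).le)

theorem singleton_partition {G : Type*} [Group G] :
    {c : Cardinal | ∃ P : Set (Set G), ⋃₀ P = Set.univ ∧
    P.PairwiseDisjoint id ∧ (∀ A ∈ P, SparseSet A) ∧ Cardinal.mk P = c}.Nonempty := by
  refine ⟨_, Set.range (fun x : G => ({x} : Set G)), ?_, ?_, ?_, rfl⟩
  · rw [Set.eq_univ_iff_forall]
    intro x
    exact ⟨_, ⟨x, rfl⟩, rfl⟩
  · rintro _ ⟨k, rfl⟩ _ ⟨l, rfl⟩ hkl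
    simp only [Function.onFun, id]
    rw [Set.disjoint_singleton]
    rintro rfl
    exact hkl rfl
  · rintro _ ⟨k, rfl⟩
    apply sparse_of_good
    intro S hS
    obtain ⟨g, hg⟩ := hS.nonempty
    refine ⟨{g}, by simpa using hg, Set.finite_singleton _, ⟨g, rfl⟩, ?_⟩
    apply Set.Subsingleton.finite
    intro x hx y hy
    have h1 : g⁻¹ * x = k := hx g rfl
    have h2 : g⁻¹ * y = k := hy g rfl
    exact mul_left_cancel (h1.trans h2.symm)

/-- If `|G| > (κ⁺)^{ℵ₀}` then `η(G) > κ`; if `|G| ≤ κ⁺` then `η(G) ≤ κ`. -/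
theorem etaSparse_bounds {G : Type*} [Group G] [Infinite G]
    (kappa : Cardinal) (hkappa : Cardinal.aleph0 ≤ kappa) :
    ((Order.succ kappa) ^ Cardinal.aleph0 < Cardinal.mk G → kappa < etaSparse G) ∧
    (Cardinal.mk G ≤ Order.succ kappa → etaSparse G ≤ kappa) := by
  refine ⟨?_, eta_aux_upper kappa hkappa⟩
  intro h
  by_contra hle
  rw [not_lt] at hle
  obtain ⟨P, hU, -, hS, hc⟩ := csInf_mem (singleton_partition (G := G))
  exact eta_aux_lower kappa hkappa h P hU hS (hc.le.trans hle)
end
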